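/- Let a ∈ ℝ ∪ {−∞} and let φ : (a,∞) → ℝ be smooth with φ'(t) > 0 and φ''(t) ≥ 0 for all t. Suppose there are β > 0 and a real sequence (aₙ)_{n≥1} such that for all sufficiently large t, φ'(t) = β + Σ_{n≥1} aₙ·t^{−n}, where the power series Σ aₙ·wⁿ converges on a neighborhood of w = 0 (i.e. w ↦ φ'(1/w) − β is real-analytic at 0 and vanishes there), and assume either all aₙ vanish or the first non-vanishing aₖ is negative. Let r₀ > 0, u₀ ∈ (a,∞), 0 ≤ u₁ ≤ r₀·φ'(u₀), and let u : [r₀,∞) → (a,∞) be the solution of u''(r) = (1 + u'(r)²)·(φ'(u(r)) − u'(r)/r) with u(r₀) = u₀, u'(r₀) = u₁. Define G(t) = ∫_{u₀}^{t} dξ/φ'(ξ). Then there exist c ∈ ℝ, M > 0 and r₁ ≥ r₀ such that |G(u(r)) − r²/2 + log(r)/β² − c| ≤ M·r^{−2} for all r ≥ r₁; that is, up to an additive constant, G(u(r)) = r²/2 − (1/β²)·log(r) + O(r^{−2}) as r → ∞. -/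

import Mathlib

open Set Filter
open scoped Topology

lemma aux_mono {f f' : ℝ → ℝ} {R : ℝ} (hf : ∀ r ∈ Ici R, HasDerivWithinAt f (f' r) (Ici R) r)
    (h : ∀ r ∈ Ici R, 0 ≤ f' r) : MonotoneOn f (Ici R) := by
  apply monotoneOn_of_hasDerivWithinAt_nonneg (f' := f') (convex_Ici R)
    (fun r hr => (hf r hr).continuousWithinAt)
  · intro x hx
    exact (hf x (interior_subset hx)).mono interior_subset
  · intro x hx
    exact h x (interior_subset hx)

lemma aux_barrier {f f' B B' : ℝ → ℝ} {R : ℝ}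
    (hf : ∀ r ∈ Ici R, HasDerivWithinAt f (f' r) (Ici R) r)
    (hB : ∀ r ∈ Ici R, HasDerivWithinAt B (B' r) (Ici R) r)
    (h0 : f R ≤ B R) (h : ∀ r ∈ Ici R, f r = B r → f' r < B' r) :
    ∀ r ∈ Ici R, f r ≤ B r := by
  intro r hr
  refine image_le_of_deriv_right_lt_deriv_boundary' (a := R) (b := r) (f := f) (f' := f')
    (B := B) (B' := B') ?_ ?_ h0 ?_ ?_ ?_ (right_mem_Icc.2 hr)
  · intro x hx
    exact (hf x hx.1).continuousWithinAt.mono Icc_subset_Ici_self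
  · intro x hx
    exact (hf x hx.1).mono (Ici_subset_Ici.2 hx.1)
  · intro x hx
    exact (hB x hx.1).continuousWithinAt.mono Icc_subset_Ici_self
  · intro x hx
    exact (hB x hx.1).mono (Ici_subset_Ici.2 hx.1)
  · intro x hx
    exact h x hx.1

lemma aux_damp (f f' : ℝ → ℝ) (j : ℕ) (K m : ℝ) (hm : 0 < m)
    (h : ∀ᶠ r in atTop, HasDerivAt f (f' r) r ∧
      (0 ≤ f r → f' r ≤ K / r ^ j - m * r * f r)) :
    ∃ C : ℝ, 0 < C ∧ ∀ᶠ r in atTop, f r ≤ C / r ^ (j + 1) := by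
  have h2 : ∀ᶠ r : ℝ in atTop, (j + 1 : ℝ) / r ^ 2 ≤ m / 2 := by
    have : Tendsto (fun r : ℝ => (j + 1 : ℝ) / r ^ 2) atTop (𝓝 0) :=
      tendsto_const_nhds.div_atTop (tendsto_pow_atTop (by norm_num))
    exact this.eventually_le_const (by positivity)
  obtain ⟨R, hR⟩ := eventually_atTop.1 (h.and (h2.and (eventually_ge_atTop (1 : ℝ))))
  have hR1 : 1 ≤ R := (hR R le_rfl).2.2
  set C : ℝ := |f R| * R ^ (j + 1) + 2 * |K| / m + 1 with hC
  have hC0 : 0 < C := by positivity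
  have hCK : K < C * (m / 2) := by
    have : |K| = (2 * |K| / m) * (m / 2) := by field_simp
    have h1 : 0 < (|f R| * R ^ (j + 1) + 1) * (m / 2) := by positivity
    have := le_abs_self K
    rw [hC]; nlinarith
  refine ⟨C, hC0, eventually_atTop.2 ⟨R, ?_⟩⟩
  refine aux_barrier (f := f) (f' := f') (B := fun r => C / r ^ (j + 1))
    (B' := fun r => - (C * (j + 1)) / r ^ (j + 2)) ?_ ?_ ?_ ?_
  · intro r hr
    exact (hR r hr).1.1.hasDerivWithinAt
  · intro r hr
    have hr1 : 0 < r := lt_of_lt_of_le one_pos (hR r hr).2.2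
    have := ((hasDerivAt_const r C).div (hasDerivAt_pow (j + 1) r) (by positivity))
    refine HasDerivAt.hasDerivWithinAt (this.congr_deriv ?_)
    push_cast
    field_simp
    ring
  · rw [le_div_iff₀ (by positivity), hC]
    have : f R * R ^ (j + 1) ≤ |f R| * R ^ (j + 1) := by gcongr; exact le_abs_self _
    have : 0 ≤ 2 * |K| / m := by positivity
    linarith
  · intro r hr hfr
    obtain ⟨⟨-, hd⟩, hj, hr1⟩ := hR r hr
    have hr0 : 0 < r := by linarith
    have := hd (by rw [hfr]; positivity)
    refine lt_of_le_of_lt this ?_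
    rw [hfr]
    have e1 : K / r ^ j - m * r * (C / r ^ (j + 1)) = (K - m * C) / r ^ j := by
      field_simp
      ring
    have e2 : -(C * (j + 1)) / r ^ (j + 2) = (- C * ((j + 1 : ℝ) / r ^ 2)) / r ^ j := by
      field_simp
      ring
    rw [e1, e2]
    have : C * ((j + 1 : ℝ) / r ^ 2) ≤ C * (m / 2) := by gcongr
    gcongr
    linarith

lemma aux_series (β : ℝ) (φ' φ'' : ℝ → ℝ) (cs : ℕ → ℝ) (hcs0 : cs 0 = 0)
    (ε : ℝ) (hε : 0 < ε)
    (hsum : ∀ w : ℝ, |w| < ε → Summable (fun n => cs n * w ^ n))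
    (T : ℝ) (hT0 : 0 < T) 
    (hexp : ∀ t : ℝ, T ≤ t → φ' t = β + ∑' n, cs n * (t⁻¹) ^ n)
    (hd : ∀ t, T ≤ t → HasDerivAt φ' (φ'' t) t) :
    ∃ K : ℝ, 0 < K ∧ ∀ᶠ t in atTop, |φ' t - β| ≤ K / t ∧ |φ'' t| ≤ K / t ^ 2 := by
  set f : ℝ → ℝ := fun w => ∑' n, cs n * w ^ n with hf
  have hA : AnalyticAt ℝ f 0 := by
    set p := FormalMultilinearSeries.ofScalars ℝ (𝕜 := ℝ) cs
    have hrad : 0 < p.radius := by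
      have h1 : (ENNReal.ofReal (ε / 2)) ≤ p.radius := by
        have : Tendsto (fun n => ‖p n‖ * ((ε/2).toNNReal : ℝ) ^ n) atTop (𝓝 0) := by
          have := (hsum (ε/2) (by rw [abs_of_pos (by positivity)]; linarith)).tendsto_atTop_zero
          have := this.norm
          simp only [norm_zero] at this
          refine this.congr (fun n => ?_)
          have hh : 0 < ε / 2 := by positivity
          simp [p, norm_mul, Real.coe_toNNReal _ hh.le,
            abs_of_pos hε]
        exact p.le_radius_of_tendsto this
      exact lt_of_lt_of_le (by simpa using hε) h1
    have := p.hasFPowerSeriesOnBall hrad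
    have h2 : p.sum = f := by
      ext w
      simp [p, FormalMultilinearSeries.sum, hf, mul_comm]
    rw [h2] at this
    exact this.analyticAt
  have hf0 : f 0 = 0 := by
    have : ∀ n, cs n * (0:ℝ) ^ n = 0 := by
      intro n; rcases n with _ | n
      · simp [hcs0]
      · simp
    simp [hf, this]
  have hinv : Tendsto (fun t : ℝ => t⁻¹) atTop (𝓝 0) := tendsto_inv_atTop_zero
  have hO : f =O[𝓝 0] (fun w : ℝ => w) := by
    have := hA.differentiableAt.isBigO_sub
    simpa [hf0] using this
  obtain ⟨K1, hK1, hb1⟩ := hO.exists_pos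
  have hb1 := hinv.eventually hb1.bound
  have hcd : ContinuousAt (deriv f) 0 := hA.deriv.continuousAt
  have hb2 : ∀ᶠ w in 𝓝 (0:ℝ), |deriv f w| < |deriv f 0| + 1 :=
    hcd.abs.eventually_lt_const (by linarith)
  have hb2 := hinv.eventually hb2
  have hb3 := hinv.eventually (hA.eventually_analyticAt)
  refine ⟨K1 + (|deriv f 0| + 1), by positivity, ?_⟩
  filter_upwards [hb1, hb2, hb3, eventually_gt_atTop T] with t h1 h2 h3 h4
  have ht : 0 < t := hT0.trans h4
  have hn := abs_nonneg (deriv f 0)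
  constructor
  · rw [hexp t h4.le]
    simp only [Real.norm_eq_abs, abs_inv, abs_of_pos ht] at h1
    have : β + ∑' n, cs n * (t⁻¹) ^ n - β = f t⁻¹ := by simp [hf]
    rw [this, div_eq_mul_inv]
    refine h1.trans ?_
    gcongr
    linarith
  · have hD : HasDerivAt (fun s => β + f s⁻¹) (deriv f t⁻¹ * (-(t ^ 2)⁻¹)) t :=
      (h3.differentiableAt.hasDerivAt.comp t (hasDerivAt_inv ht.ne')).const_add β
    have hE : φ' =ᶠ[𝓝 t] (fun s => β + f s⁻¹) := by
      filter_upwards [eventually_gt_nhds h4] with s hs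
      exact hexp s hs.le
    rw [(hd t h4.le).unique (hD.congr_of_eventuallyEq hE), abs_mul, abs_neg, abs_inv,
      abs_of_pos (by positivity : 0 < t ^ 2), div_eq_mul_inv]
    gcongr
    linarith

lemma aux_limit (D D' : ℝ → ℝ) (K : ℝ) (hK : 0 < K)
    (h : ∀ᶠ r in atTop, HasDerivAt D (D' r) r ∧ |D' r| ≤ K / r ^ 3) :
    ∃ c : ℝ, ∀ᶠ r in atTop, |D r - c| ≤ K / r ^ 2 := by
  obtain ⟨R, hR⟩ := eventually_atTop.1 (h.and (eventually_ge_atTop (1 : ℝ)))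
  have hR1 : 1 ≤ R := (hR R le_rfl).2
  have hq : ∀ r, R ≤ r → HasDerivAt (fun r : ℝ => (K / 2) / r ^ 2) (- (K / r ^ 3)) r := by
    intro r hr
    have hr0 : 0 < r := by linarith
    refine ((hasDerivAt_const r (K / 2)).div (hasDerivAt_pow 2 r) (by positivity)).congr_deriv ?_
    field_simp
    norm_num
    ring
  have m1 : MonotoneOn (fun r => D r - (K / 2) / r ^ 2) (Ici R) :=
    aux_mono (f' := fun r => D' r - (- (K / r ^ 3)))
      (fun r hr => ((hR r hr).1.1.sub (hq r hr)).hasDerivWithinAt)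
      (fun r hr => by have := neg_le_of_abs_le (hR r hr).1.2; linarith)
  have m2 : MonotoneOn (fun r => - (K / 2) / r ^ 2 - D r) (Ici R) :=
    aux_mono (f' := fun r => - (- (K / r ^ 3)) - D' r)
      (fun r hr => by
        have := ((hq r hr).neg.sub (hR r hr).1.1).hasDerivWithinAt (s := Ici R)
        refine this.congr_of_mem (fun x _ => ?_) hr
        simp [neg_div])
      (fun r hr => by have := le_of_abs_le (hR r hr).1.2; linarith)
  have key : ∀ r ∈ Ici R, ∀ s ∈ Ici R, D s - (K / 2) / s ^ 2 ≤ D r + (K / 2) / r ^ 2 := by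
    intro r hr s hs
    have hr0 : 0 < r := by have : R ≤ r := hr; linarith
    have hs0 : 0 < s := by have : R ≤ s := hs; linarith
    have p1 : 0 < (K / 2) / r ^ 2 := by positivity
    have p2 : 0 < (K / 2) / s ^ 2 := by positivity
    rcases le_total r s with h | h
    · have := m2 hr hs h
      simp only [neg_div] at this; linarith
    · have := m1 hs hr h
      simp only at this; linarith
  refine ⟨sSup ((fun r => D r - (K / 2) / r ^ 2) '' Ici R), eventually_atTop.2 ⟨R, fun r hr => ?_⟩⟩
  have hr0 : 0 < r := by linarith
  have p1 : 0 < (K / 2) / r ^ 2 := by positivity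
  have b1 : D r - (K / 2) / r ^ 2 ≤ sSup ((fun r => D r - (K / 2) / r ^ 2) '' Ici R) := by
    apply le_csSup
    · refine ⟨D R + (K / 2) / R ^ 2, ?_⟩
      rintro _ ⟨s, hs, rfl⟩
      exact key R (le_refl R) s hs
    · exact ⟨r, hr, rfl⟩
  have b2 : sSup ((fun r => D r - (K / 2) / r ^ 2) '' Ici R) ≤ D r + (K / 2) / r ^ 2 := by
    apply csSup_le (nonempty_Ici.image _)
    rintro _ ⟨s, hs, rfl⟩
    exact key r hr s hs
  have e : K / r ^ 2 = (K / 2) / r ^ 2 + (K / 2) / r ^ 2 := by ring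
  rw [abs_le]; constructor <;> linarith

/-- Suppose `φ' > 0`, `φ'' ≥ 0` on `(a,∞)` and, for large `t`,
`φ'(t) = β + Σ_{n≥1} aₙ t⁻ⁿ` with `β > 0` (a convergent power series in `t⁻¹`, with
either all `aₙ = 0` or the first non-vanishing coefficient negative).  Then, with
`G(t) = ∫_{u₀}^t dξ/φ'(ξ)`, any solution `u` of the rotational `[φ,e₃]`-minimal
equation on `[r₀,∞)` with `u(r₀) = u₀`, `u'(r₀) = u₁`, `0 ≤ u₁ ≤ r₀·φ'(u₀)` satisfies,
up to an additive constant, `G(u(r)) = r²/2 - log(r)/β² + O(r⁻²)` as `r → ∞`. -/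
theorem stmt_19 (a : EReal) (β : ℝ) (hβ : 0 < β) (φ φ' φ'' : ℝ → ℝ)
    (hφsm : ContDiffOn ℝ (⊤ : ℕ∞) φ {t : ℝ | a < (t : EReal)})
    (hφd : ∀ t : ℝ, a < (t : EReal) → HasDerivAt φ (φ' t) t)
    (hφd2 : ∀ t : ℝ, a < (t : EReal) → HasDerivAt φ' (φ'' t) t)
    (hφ'pos : ∀ t : ℝ, a < (t : EReal) → 0 < φ' t)
    (hφ''nn : ∀ t : ℝ, a < (t : EReal) → 0 ≤ φ'' t)
    -- the expansion `φ'(t) = β + Σ_{n ≥ 1} aₙ t⁻ⁿ` for large `t`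
    (cs : ℕ → ℝ) (hcs0 : cs 0 = 0)
    (ε : ℝ) (hε : 0 < ε)
    (hsum : ∀ w : ℝ, |w| < ε → Summable (fun n => cs n * w ^ n))
    (T : ℝ) (hT0 : 0 < T) (hTa : a < (T : EReal)) (hTε : T⁻¹ < ε)
    (hexp : ∀ t : ℝ, T ≤ t → φ' t = β + ∑' n, cs n * (t⁻¹) ^ n)
    -- either all coefficients vanish or the first non-vanishing one is negative
    (hsign : (∀ n, cs n = 0) ∨ ∃ k, cs k < 0 ∧ ∀ m < k, cs m = 0)
    -- the solution
    (r₀ : ℝ) (hr₀ : 0 < r₀)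
    (u₀ : ℝ) (hu₀ : a < (u₀ : EReal))
    (u₁ : ℝ) (hu₁ : 0 ≤ u₁) (hslope : u₁ ≤ r₀ * φ' u₀)
    (u u' : ℝ → ℝ)
    (hmem : ∀ r ∈ Ici r₀, a < (u r : EReal))
    (h0 : u r₀ = u₀) (h0' : u' r₀ = u₁)
    (hd : ∀ r ∈ Ici r₀, HasDerivWithinAt u (u' r) (Ici r₀) r)
    (hd2 : ∀ r ∈ Ici r₀,
      HasDerivWithinAt u' ((1 + u' r ^ 2) * (φ' (u r) - u' r / r)) (Ici r₀) r) :
    ∃ c M r₁ : ℝ, 0 < M ∧ r₀ ≤ r₁ ∧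
      ∀ r : ℝ, r₁ ≤ r →
        |(∫ ξ in u₀..(u r), 1 / φ' ξ) - r ^ 2 / 2 + Real.log r / β ^ 2 - c|
          ≤ M / r ^ 2 := by
  have hdom : ∀ x z : ℝ, a < (x : EReal) → x ≤ z → a < (z : EReal) := by
    intro x z hx hz
    exact lt_of_lt_of_le hx (by exact_mod_cast hz)
  obtain ⟨K, hK, hser⟩ := aux_series β φ' φ'' cs hcs0 ε hε hsum T hT0 hexp
    (fun t ht => hφd2 t (hdom T t hTa ht))
  have hpd : ∀ r ∈ Ici r₀, HasDerivWithinAt (fun r => φ' (u r)) (φ'' (u r) * u' r) (Ici r₀) r :=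
    fun r hr => (hφd2 (u r) (hmem r hr)).comp_hasDerivWithinAt r (hd r hr)
  have hppos : ∀ r ∈ Ici r₀, 0 < φ' (u r) := fun r hr => hφ'pos _ (hmem r hr)
  have hrpos : ∀ r ∈ Ici r₀, 0 < r := fun r hr => lt_of_lt_of_le hr₀ hr
  -- F1
  have F1 : ∀ r ∈ Ici r₀, u' r - r * φ' (u r) ≤ 0 := by
    refine aux_barrier (f := fun r => u' r - r * φ' (u r)) (B := fun _ => 0) (B' := fun _ => 0)
      (fun r hr => (hd2 r hr).sub ((hasDerivWithinAt_id r _).mul (hpd r hr)))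
      (fun r hr => hasDerivWithinAt_const _ _ _) ?_ ?_
    · simp only [h0, h0']; linarith
    · intro r hr h
      have hr0 := hrpos r hr
      have hp := hppos r hr
      have hv : u' r = r * φ' (u r) := by linarith
      have h2 := hφ''nn (u r) (hmem r hr)
      have e : φ' (u r) - u' r / r = 0 := by rw [hv]; field_simp; ring
      simp only [e, id]
      have : 0 ≤ r * (φ'' (u r) * u' r) := by rw [hv]; positivity
      linarith
  have F1' : ∀ r ∈ Ici r₀, 0 ≤ φ' (u r) - u' r / r := by
    intro r hr
    have hr0 := hrpos r hr
    have := F1 r hr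
    rw [sub_nonneg, div_le_iff₀ hr0]; linarith
  -- F2
  have F2 : MonotoneOn u' (Ici r₀) := aux_mono hd2 (fun r hr =>
    mul_nonneg (by positivity) (F1' r hr))
  have F2' : ∀ r ∈ Ici r₀, 0 ≤ u' r := by
    intro r hr
    have := F2 (le_refl r₀ : r₀ ∈ Ici r₀) hr hr
    rw [h0'] at this; linarith
  have F2p : MonotoneOn (fun r => φ' (u r)) (Ici r₀) := aux_mono hpd (fun r hr =>
    mul_nonneg (hφ''nn _ (hmem r hr)) (F2' r hr))
  set p0 := φ' u₀ with hp0
  have hp0pos : 0 < p0 := hφ'pos _ hu₀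
  have F2p' : ∀ r ∈ Ici r₀, p0 ≤ φ' (u r) := by
    intro r hr
    have := F2p (le_refl r₀ : r₀ ∈ Ici r₀) hr hr
    simpa [h0] using this
  -- F3
  have F3a : MonotoneOn (fun r => r * u' r - p0 / 2 * r ^ 2) (Ici r₀) := by
    refine aux_mono (fun r hr => ((hasDerivWithinAt_id r _).mul (hd2 r hr)).sub
      (((hasDerivAt_pow 2 r).const_mul (p0 / 2)).hasDerivWithinAt)) ?_
    intro r hr
    have hr0 := hrpos r hr
    have h1 := F1' r hr
    have h2 := F2p' r hr
    have h3 : r * (u' r / r) = u' r := by field_simp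
    have h4 : 0 ≤ r * (u' r ^ 2 * (φ' (u r) - u' r / r)) := by positivity
    have h5 : 0 ≤ r * (φ' (u r) - p0) := mul_nonneg hr0.le (by linarith)
    simp only [id]
    norm_num
    nlinarith
  have F3 : ∀ᶠ r in atTop, p0 / 4 * r ≤ u' r := by
    filter_upwards [eventually_ge_atTop (2 * r₀)] with r hr
    have hr' : r ∈ Ici r₀ := by simp only [mem_Ici]; linarith
    have hr0 := hrpos r hr'
    have := F3a (le_refl r₀ : r₀ ∈ Ici r₀) hr' hr'
    simp only [h0'] at this
    have h1 : 0 ≤ r₀ * u₁ := by positivity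
    have h2 : r₀ ^ 2 ≤ r ^ 2 / 2 := by nlinarith
    have h3 : p0 / 2 * r₀ ^ 2 ≤ p0 / 2 * (r ^ 2 / 2) := by gcongr
    have h4 : r * (p0 / 4 * r) ≤ r * u' r := by nlinarith
    exact le_of_mul_le_mul_left h4 hr0
  -- F4
  have F4 : ∀ᶠ r in atTop, p0 / 16 * r ^ 2 ≤ u r := by
    obtain ⟨R, hR⟩ := eventually_atTop.1 (F3.and (eventually_ge_atTop r₀))
    have hRr : r₀ ≤ R := (hR R le_rfl).2
    have hm : MonotoneOn (fun r => u r - p0 / 8 * r ^ 2) (Ici R) := by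
      refine aux_mono (fun r hr => ((hd r (hR r hr).2).mono (Ici_subset_Ici.2 hRr)).sub
        (((hasDerivAt_pow 2 r).const_mul (p0 / 8)).hasDerivWithinAt)) ?_
      intro r hr
      have := (hR r hr).1
      norm_num
      linarith
    have ht : Tendsto (fun r : ℝ => p0 / 16 * r ^ 2) atTop atTop :=
      (tendsto_pow_atTop (by norm_num)).const_mul_atTop (by positivity)
    filter_upwards [ht.eventually_ge_atTop (-(u R - p0 / 8 * R ^ 2)), eventually_ge_atTop R]
      with r h1 h2
    have := hm (le_refl R : R ∈ Ici R) h2 h2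
    simp only at this
    linarith
  have hutop : Tendsto u atTop atTop := by
    have ht : Tendsto (fun r : ℝ => p0 / 16 * r ^ 2) atTop atTop :=
      (tendsto_pow_atTop (by norm_num)).const_mul_atTop (by positivity)
    exact tendsto_atTop_mono' _ F4 ht
  -- F5
  obtain ⟨K1, hK1, F5⟩ : ∃ K1 : ℝ, 0 < K1 ∧ ∀ᶠ r in atTop,
      |φ' (u r) - β| ≤ K1 / r ^ 2 ∧ φ'' (u r) ≤ K1 / r ^ 4 := by
    refine ⟨K / (p0 / 16) + K / (p0 / 16) ^ 2, by positivity, ?_⟩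
    filter_upwards [F4, hutop.eventually hser, eventually_gt_atTop 0] with r h1 h2 h3
    have hq : 0 < p0 / 16 := by positivity
    constructor
    · refine h2.1.trans ?_
      calc K / u r ≤ K / (p0 / 16 * r ^ 2) := by gcongr
        _ = K / (p0 / 16) / r ^ 2 := by rw [div_div]
        _ ≤ _ := by gcongr; have : 0 < K / (p0 / 16) ^ 2 := by positivity
                    linarith
    · refine (le_abs_self _).trans (h2.2.trans ?_)
      calc K / u r ^ 2 ≤ K / (p0 / 16 * r ^ 2) ^ 2 := by gcongr
        _ = K / (p0 / 16) ^ 2 / r ^ 4 := by rw [div_div]; ring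
        _ ≤ _ := by gcongr; have : 0 < K / (p0 / 16) := by positivity
                    linarith
  -- the function `w`
  set A : ℝ → ℝ := fun r => (1 + u' r ^ 2) / r with hA
  set y : ℝ → ℝ := fun r => u' r / φ' (u r) with hy
  set w : ℝ → ℝ := fun r => r - y r with hw
  have hyle : ∀ r ∈ Ici r₀, 0 ≤ y r ∧ y r ≤ r := by
    intro r hr
    have := F1 r hr
    refine ⟨div_nonneg (F2' r hr) (hppos r hr).le, ?_⟩
    simp only [hy]
    rw [div_le_iff₀ (hppos r hr)]; linarith
  have hwd : ∀ r, r₀ < r → HasDerivAt w (1 + y r ^ 2 * φ'' (u r) - A r * w r) r := by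
    intro r hr
    have hr' : r ∈ Ici r₀ := hr.le
    have hp := hppos r hr'
    have hr0 := hrpos r hr'
    have hn : Ici r₀ ∈ 𝓝 r := Ici_mem_nhds hr
    have := (hasDerivAt_id r).sub (((hd2 r hr').hasDerivAt hn).div
      ((hpd r hr').hasDerivAt hn) hp.ne')
    refine this.congr_deriv ?_
    simp only [hA, hw, hy]
    field_simp
    ring
  have hyφ : ∀ᶠ r in atTop, 0 ≤ y r ^ 2 * φ'' (u r) ∧ y r ^ 2 * φ'' (u r) ≤ K1 / r ^ 2 := by
    filter_upwards [F5, eventually_ge_atTop r₀] with r h1 h2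
    have hr0 := hrpos r h2
    obtain ⟨h3, h4⟩ := hyle r h2
    have h5 := hφ''nn _ (hmem r h2)
    refine ⟨by positivity, ?_⟩
    calc y r ^ 2 * φ'' (u r) ≤ r ^ 2 * (K1 / r ^ 4) := by gcongr; exact h1.2
      _ = K1 / r ^ 2 := by field_simp
  set m : ℝ := (p0 / 4) ^ 2 with hm
  have hmpos : 0 < m := by positivity
  have hAm : ∀ᶠ r in atTop, m * r ≤ A r := by
    filter_upwards [F3, eventually_gt_atTop 0] with r h1 h2
    simp only [hA]
    rw [le_div_iff₀ h2]
    have : (p0 / 4 * r) ^ 2 ≤ u' r ^ 2 := by gcongr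
    rw [hm]; nlinarith
  -- F6
  obtain ⟨C, hC, F6⟩ : ∃ C : ℝ, 0 < C ∧ ∀ᶠ r in atTop, w r ≤ C / r ^ (0 + 1) := by
    refine aux_damp w (fun r => 1 + y r ^ 2 * φ'' (u r) - A r * w r) 0 (1 + K1) m hmpos ?_
    filter_upwards [hyφ, hAm, eventually_gt_atTop r₀, eventually_ge_atTop 1] with r h1 h2 h3 h4
    refine ⟨hwd r h3, fun h => ?_⟩
    have h5 : K1 / r ^ 2 ≤ K1 := div_le_self hK1.le (one_le_pow₀ h4)
    have h6 : m * r * w r ≤ A r * w r := by gcongr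
    rw [pow_zero, div_one]
    linarith [h1.2]
  -- F7
  set e : ℝ → ℝ := fun r => w r - 1 / (β ^ 2 * r) with he
  set b : ℝ → ℝ := fun r => 1 - u' r ^ 2 / (β ^ 2 * r ^ 2) + y r ^ 2 * φ'' (u r) with hb
  have hed : ∀ r, r₀ < r → HasDerivAt e (b r - A r * e r) r := by
    intro r hr
    have hr0 := hrpos r hr.le
    have h1 := ((hasDerivAt_id r).const_mul (β ^ 2))
    have h2 := (hwd r hr).sub ((hasDerivAt_const r (1 : ℝ)).div h1
      (by simp only [id]; positivity))
    refine h2.congr_deriv ?_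
    simp only [hb, he, hA, id]
    field_simp
    ring
  obtain ⟨K2, hK2, hbb⟩ : ∃ K2 : ℝ, 0 < K2 ∧ ∀ᶠ r in atTop, |b r| ≤ K2 / r ^ 2 := by
    set L := K1 / β + C with hL
    have hLpos : 0 < L := by positivity
    refine ⟨L * (2 + L) + K1, by positivity, ?_⟩
    filter_upwards [F5, F6, hyφ, eventually_ge_atTop r₀, eventually_ge_atTop 1]
      with r h1 h2 h3 h4 h5
    have hr0 : 0 < r := by linarith
    have hp := hppos r h4
    obtain ⟨hy0, hy1⟩ := hyle r h4
    have hq1 : |u' r / (β * r) - 1| ≤ L / r ^ 2 := by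
      have e1 : u' r / (β * r) - 1 = (φ' (u r) - β) / β * (y r / r) - w r / r := by
        simp only [hw, hy]; field_simp; ring
      have e2 : |(φ' (u r) - β) / β * (y r / r)| ≤ K1 / r ^ 2 / β * 1 := by
        rw [abs_mul, abs_div, abs_of_pos hβ, abs_of_nonneg (by positivity : 0 ≤ y r / r)]
        gcongr
        · exact h1.1
        · rw [div_le_one hr0]; exact hy1
      have e3 : |w r / r| ≤ C / r ^ 2 := by
        have : 0 ≤ w r := by simp only [hw]; linarith
        rw [abs_of_nonneg (by positivity)]
        calc w r / r ≤ C / r ^ (0 + 1) / r := by gcongr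
          _ = C / r ^ 2 := by field_simp; try ring
      rw [e1]
      refine (abs_sub _ _).trans ((add_le_add e2 e3).trans (le_of_eq ?_))
      rw [hL]; field_simp
    set q := u' r / (β * r) with hq
    have hL2 : L / r ^ 2 ≤ L := div_le_self hLpos.le (one_le_pow₀ h5)
    have hq2 : |q + 1| ≤ 2 + L := by
      have := abs_le.1 (hq1.trans hL2)
      rw [abs_le]; constructor <;> linarith
    have hbq : b r = -((q - 1) * (q + 1)) + y r ^ 2 * φ'' (u r) := by
      simp only [hb, hq]; field_simp; ring
    rw [hbq]
    refine (abs_add_le _ _).trans ?_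
    rw [abs_neg, abs_mul, abs_of_nonneg h3.1]
    calc _ ≤ L / r ^ 2 * (2 + L) + K1 / r ^ 2 := by gcongr; exact h3.2
      _ = _ := by ring
  obtain ⟨C1, hC1, F7a⟩ : ∃ C : ℝ, 0 < C ∧ ∀ᶠ r in atTop, e r ≤ C / r ^ (2 + 1) := by
    refine aux_damp e (fun r => b r - A r * e r) 2 K2 m hmpos ?_
    filter_upwards [hbb, hAm, eventually_gt_atTop r₀] with r h1 h2 h3
    refine ⟨hed r h3, fun h => ?_⟩
    have h6 : m * r * e r ≤ A r * e r := by gcongr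
    linarith [le_of_abs_le h1]
  obtain ⟨C2, hC2, F7b⟩ : ∃ C : ℝ, 0 < C ∧ ∀ᶠ r in atTop, -e r ≤ C / r ^ (2 + 1) := by
    refine aux_damp (fun r => -e r) (fun r => -(b r - A r * e r)) 2 K2 m hmpos ?_
    filter_upwards [hbb, hAm, eventually_gt_atTop r₀] with r h1 h2 h3
    refine ⟨(hed r h3).neg, fun h => ?_⟩
    have h6 : m * r * (-e r) ≤ A r * (-e r) := by gcongr
    linarith [neg_le_of_abs_le h1]
  -- F8
  have hHd : ∀ r, r₀ < r → HasDerivAt (fun r => ∫ ξ in u₀..(u r), 1 / φ' ξ) (y r) r := by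
    intro r hr
    have hr' : r ∈ Ici r₀ := hr.le
    have hopen : IsOpen {t : ℝ | a < (t : EReal)} :=
      isOpen_lt continuous_const continuous_coe_real_ereal
    have hcont : ContinuousOn (fun ξ => 1 / φ' ξ) {t : ℝ | a < (t : EReal)} := fun t ht =>
      (continuousAt_const.div (hφd2 t ht).continuousAt (hφ'pos t ht).ne').continuousWithinAt
    have hsub : uIcc u₀ (u r) ⊆ {t : ℝ | a < (t : EReal)} := by
      intro t ht
      rcases le_total u₀ (u r) with h | h
      · rw [uIcc_of_le h] at ht; exact hdom _ _ hu₀ ht.1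
      · rw [uIcc_of_ge h] at ht; exact hdom _ _ (hmem r hr') ht.1
    have hG : HasDerivAt (fun t => ∫ ξ in u₀..t, 1 / φ' ξ) (1 / φ' (u r)) (u r) :=
      intervalIntegral.integral_hasDerivAt_right
        ((hcont.mono hsub).intervalIntegrable)
        (hcont.stronglyMeasurableAtFilter hopen _ (hmem r hr'))
        (hcont.continuousAt (hopen.mem_nhds (hmem r hr')))
    have := hG.comp r ((hd r hr').hasDerivAt (Ici_mem_nhds hr))
    refine this.congr_deriv ?_
    simp only [hy]; ring
  obtain ⟨c, hc⟩ := aux_limit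
    (fun r => (∫ ξ in u₀..(u r), 1 / φ' ξ) - r ^ 2 / 2 + Real.log r / β ^ 2)
    (fun r => - e r) (C1 + C2) (by positivity) (by
      filter_upwards [F7a, F7b, eventually_gt_atTop r₀] with r h1 h2 h3
      have hr0 := hrpos r h3.le
      constructor
      · have := ((hHd r h3).sub ((hasDerivAt_pow 2 r).div_const 2)).add
          ((Real.hasDerivAt_log hr0.ne').div_const (β ^ 2))
        refine this.congr_deriv ?_
        simp only [he, hw]
        field_simp
        norm_num
        try ring
      · rw [add_div]
        have q1 : 0 < C1 / r ^ 3 := by positivity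
        have q2 : 0 < C2 / r ^ 3 := by positivity
        norm_num at h1 h2
        rw [abs_le]; constructor <;> linarith)
  obtain ⟨R, hR⟩ := eventually_atTop.1 hc
  exact ⟨c, C1 + C2, max R r₀, by positivity, le_max_right _ _,
    fun r hr => hR r ((le_max_left _ _).trans hr)⟩
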